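/- For every odd integer m ≥ 7 and every integer n with n ≥ 2m + 499 and n ≥ 3493, the Ramsey number R(K_{2,n}, C_m) equals 2n + 3; that is, every graph Γ on 2n + 3 vertices contains a copy of K_{2,n} or its complement contains a cycle of length m, and this fails for some graph on 2n + 2 vertices. -/

import Mathlib

open SimpleGraph

/-- `ContainsCopy Γ H` : `Γ` contains a copy of `H`, i.e. `H` is isomorphic to a subgraph
of `Γ`; equivalently, there is an injective graph homomorphism from `H` to `Γ`. -/
def ContainsCopy {α β : Type*} (Γ : SimpleGraph α) (H : SimpleGraph β) : Prop :=
  ∃ f : H →g Γ, Function.Injective f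

/-- `G` contains a cycle of length `k`, given by its cyclic sequence of distinct vertices. -/
def HasCycle {V : Type*} (G : SimpleGraph V) (k : ℕ) : Prop :=
  ∃ x : ZMod k → V, Function.Injective x ∧ ∀ i, G.Adj (x i) (x (i + 1))

lemma zmod_val_add_one {k : ℕ} [NeZero k] (i : ZMod k) :
    (i.val + 1 < k ∧ (i + 1).val = i.val + 1) ∨ (i.val + 1 = k ∧ i + 1 = 0) := by
  have hi := i.val_lt
  have h : ((i.val + 1 : ℕ) : ZMod k) = i + 1 := by simp
  rcases (Nat.succ_le_of_lt hi).lt_or_eq with h1 | h1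
  · left
    refine ⟨h1, ?_⟩
    rw [← h, ZMod.val_natCast, Nat.mod_eq_of_lt h1]
  · right
    refine ⟨h1, ?_⟩
    rw [← h, show i.val + 1 = k from h1]
    simp

lemma hasCycle_of_sequence {V : Type*} {G : SimpleGraph V} {k : ℕ} (hk : k ≠ 0) (y : ℕ → V)
    (inj : ∀ s t, s < k → t < k → y s = y t → s = t)
    (adj : ∀ t, t + 1 < k → G.Adj (y t) (y (t + 1)))
    (last : G.Adj (y (k - 1)) (y 0)) : HasCycle G k := by
  have : NeZero k := ⟨hk⟩
  refine ⟨fun i => y i.val, fun i j h => ?_, fun i => ?_⟩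
  · exact ZMod.val_injective k (inj _ _ i.val_lt j.val_lt h)
  · rcases zmod_val_add_one i with ⟨h, h'⟩ | ⟨h, h'⟩
    · simp only [h']; exact adj _ h
    · simp only [h', ZMod.val_zero]
      rwa [show i.val = k - 1 by omega]

lemma zmod_add_natCast_inj {k : ℕ} (c : ZMod k) {s t : ℕ} (hs : s < k) (ht : t < k)
    (h : c + (s : ZMod k) = c + (t : ZMod k)) : s = t := by
  have h := (ZMod.natCast_eq_natCast_iff' s t k).1 (add_left_cancel h)
  rwa [Nat.mod_eq_of_lt hs, Nat.mod_eq_of_lt ht] at h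

lemma hasCycle_of_detour {V : Type*} {G : SimpleGraph V} {k : ℕ} (hk : 3 ≤ k) {x : ZMod k → V}
    (hinj : Function.Injective x) (hadj : ∀ i, G.Adj (x i) (x (i + 1))) {a d b : V} {i : ZMod k}
    (ha : ∀ j, x j ≠ a) (hd : ∀ j, x j ≠ d) (hb : ∀ j, x j ≠ b) (hab : a ≠ b)
    (hxa : G.Adj a (x i)) (had : G.Adj a d) (hdb : G.Adj d b) (hbx : G.Adj b (x (i + 2))) :
    HasCycle G (k + 2) := by
  set y : ℕ → V := fun t => x (i + 2 + t) with hy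
  have yinj : ∀ s t, s < k → t < k → y s = y t → s = t := fun s t hs ht h =>
    zmod_add_natCast_inj _ hs ht (hinj h)
  have yadj : ∀ t, G.Adj (y t) (y (t + 1)) := fun t => by
    simpa [hy, add_assoc] using hadj (i + 2 + t)
  have ya : ∀ t, y t ≠ a := fun t => ha _
  have yb : ∀ t, y t ≠ b := fun t => hb _
  have yd : ∀ t, y t ≠ d := fun t => hd _
  have y0 : y 0 = x (i + 2) := by simp [hy]
  have yl : y (k - 2) = x i := by
    simp only [hy, Nat.cast_sub (show 2 ≤ k by omega)]
    congr 1
    simp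
  clear_value y
  refine hasCycle_of_sequence (by omega)
    (fun t => if t < k - 1 then y t else if t = k - 1 then a else if t = k then d else b)
    ?_ ?_ ?_
  · intro s t hs ht h
    have := had.ne
    have := hdb.ne
    have := yinj s t
    split_ifs at h <;> first | omega | (exfalso; grind) | grind
  · intro t ht
    by_cases h1 : t + 1 < k - 1
    · rw [if_pos (by omega), if_pos h1]; exact yadj t
    by_cases h2 : t + 1 = k - 1
    · rw [if_pos (by omega), if_neg h1, if_pos h2, show t = k - 2 by omega, yl]; exact hxa.symm
    by_cases h3 : t + 1 = k
    · rw [if_neg (by omega), if_pos (by omega), if_neg h1, if_neg h2, if_pos h3]; exact had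
    · rw [if_neg (by omega), if_neg (by omega), if_pos (by omega), if_neg h1, if_neg h2,
        if_neg h3]
      exact hdb
  · rw [if_neg (by omega), if_neg (by omega), if_neg (by omega), if_pos (by omega), y0]
    exact hbx

lemma hasCycle_of_crossing {V : Type*} {G : SimpleGraph V} {k : ℕ} [NeZero k] {x : ZMod k → V}
    (hinj : Function.Injective x) (hadj : ∀ i, G.Adj (x i) (x (i + 1))) {a b : V} {i j : ZMod k}
    (hij : i ≠ j) (ha : ∀ j, x j ≠ a) (hb : ∀ j, x j ≠ b) (hab : a ≠ b)
    (hai : G.Adj a (x i)) (haj : G.Adj a (x j))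
    (hbi : G.Adj b (x (i + 1))) (hbj : G.Adj b (x (j + 1))) :
    HasCycle G (k + 2) := by
  set y : ℕ → V := fun t => x (i + 1 + t) with hy
  obtain ⟨r, hr, hjr⟩ : ∃ r < k, j = i + 1 + (r : ZMod k) :=
    ⟨(j - (i + 1)).val, ZMod.val_lt _, by rw [ZMod.natCast_zmod_val]; ring⟩
  have yinj : ∀ s t, s < k → t < k → y s = y t → s = t := fun s t hs ht h =>
    zmod_add_natCast_inj _ hs ht (hinj h)
  have yadj : ∀ t, G.Adj (y t) (y (t + 1)) := fun t => by
    simpa [hy, add_assoc] using hadj (i + 1 + t)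
  have ya : ∀ t, y t ≠ a := fun t => ha _
  have yb : ∀ t, y t ≠ b := fun t => hb _
  have y0 : y 0 = x (i + 1) := by simp [hy]
  have hk : 0 < k := NeZero.pos k
  have hil : i = i + 1 + ((k - 1 : ℕ) : ZMod k) := by
    rw [Nat.cast_sub (by omega)]; simp
  have yl : y (k - 1) = x i := congrArg x hil.symm
  have yr : y r = x j := by rw [hjr]
  have yr' : y (r + 1) = x (j + 1) := by rw [hjr]; simp [hy, add_assoc]
  have hrk : r + 1 < k := by
    by_contra h
    apply hij
    rw [hjr, show r = k - 1 by omega]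
    exact hil
  clear_value y
  refine hasCycle_of_sequence (by omega)
    (fun t => if t < r + 1 then y t else if t = r + 1 then a else
      if t = k + 1 then b else y (k + 1 + r - t)) ?_ ?_ ?_
  · intro s t hs ht h
    have := yinj s t
    have := yinj s (k + 1 + r - t)
    have := yinj (k + 1 + r - s) t
    have := yinj (k + 1 + r - s) (k + 1 + r - t)
    split_ifs at h <;> first | omega | (exfalso; grind) | grind
  · intro t ht
    by_cases h1 : t + 1 < r + 1
    · rw [if_pos (by omega), if_pos h1]; exact yadj t
    by_cases h2 : t = r
    · rw [if_pos (by omega), if_neg h1, if_pos (by omega), h2, yr]; exact haj.symm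
    by_cases h3 : t = r + 1
    · rw [if_neg (by omega), if_pos h3, if_neg h1, if_neg (by omega), if_neg (by omega),
        show k + 1 + r - (t + 1) = k - 1 by omega, yl]
      exact hai
    by_cases h4 : t = k
    · rw [if_neg (by omega), if_neg (by omega), if_neg (by omega), if_neg (by omega),
        if_neg (by omega), if_pos (by omega), show k + 1 + r - t = r + 1 by omega, yr']
      exact hbj.symm
    · rw [if_neg (by omega), if_neg (by omega), if_neg (by omega), if_neg (by omega),
        if_neg (by omega), if_neg (by omega),
        show k + 1 + r - t = k + 1 + r - (t + 1) + 1 by omega]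
      exact (yadj _).symm
  · rw [if_neg (by omega), if_neg (by omega), if_pos (by omega), if_pos (by omega), y0]
    exact hbi

lemma exists_consecutive_disjoint_choice {V : Type*} [DecidableEq V] {k : ℕ} (hk : 2 ≤ k)
    (P : ZMod k → Finset V → Prop)
    (h : ∀ i (F : Finset V), F.card ≤ 4 → ∃ A : Finset V, A.card ≤ 2 ∧ Disjoint A F ∧ P i A) :
    ∃ A : ZMod k → Finset V, ∀ i, P i (A i) ∧ Disjoint (A i) (A (i + 1)) := by
  have : NeZero k := ⟨by omega⟩
  have h' : ∀ i (F : Finset V), ∃ A : Finset V, F.card ≤ 4 → A.card ≤ 2 ∧ Disjoint A F ∧ P i A := by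
    intro i F
    by_cases hF : F.card ≤ 4
    · obtain ⟨A, hA⟩ := h i F hF; exact ⟨A, fun _ => hA⟩
    · exact ⟨∅, fun h => absurd h hF⟩
  choose f hf using h'
  let B : ℕ → Finset V := fun j => Nat.rec (f 0 ∅)
    (fun (j : ℕ) Bj => f ((j + 1 : ℕ) : ZMod k) (f 0 ∅ ∪ Bj)) j
  have B0 : B 0 = f 0 ∅ := rfl
  have Bs : ∀ j, B (j + 1) = f ((j + 1 : ℕ) : ZMod k) (B 0 ∪ B j) := fun j => rfl
  have h0 := hf 0 ∅ (by simp)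
  rw [← B0] at h0
  have hB : ∀ j, (B j).card ≤ 2 := by
    intro j
    induction j with
    | zero => exact h0.1
    | succ j ih =>
      rw [Bs]
      exact (hf _ _ ((Finset.card_union_le _ _).trans (by have := h0.1; omega))).1
  have hs : ∀ j, Disjoint (B (j + 1)) (B 0 ∪ B j) ∧ P ((j + 1 : ℕ) : ZMod k) (B (j + 1)) := by
    intro j
    rw [Bs]
    exact (hf _ _ ((Finset.card_union_le _ _).trans (by have := h0.1; have := hB j; omega))).2
  clear_value B
  refine ⟨fun i => B i.val, fun i => ⟨?_, ?_⟩⟩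
  · rcases Nat.eq_zero_or_eq_succ_pred i.val with h | h
    · have : i = 0 := (ZMod.val_eq_zero i).1 h
      subst this
      simpa [h] using h0.2.2
    · have := (hs (i.val - 1)).2
      rw [show i.val - 1 + 1 = i.val by omega, ZMod.natCast_zmod_val] at this
      exact this
  · rcases zmod_val_add_one i with ⟨_, h⟩ | ⟨h, h'⟩
    · simp only [h]
      exact (Disjoint.mono_right Finset.subset_union_right (hs _).1).symm
    · simp only [h', ZMod.val_zero]
      have := (hs (i.val - 1)).1
      rw [show i.val - 1 + 1 = i.val by omega] at this
      exact Disjoint.mono_right Finset.subset_union_left this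

lemma card_le_of_shift_disjoint {k : ℕ} [NeZero k] (hk : Odd k) (J : Finset (ZMod k))
    (h : ∀ i ∈ J, i + 2 ∉ J) : 2 * J.card ≤ k - 1 := by
  have hd : Disjoint J (J.map (Equiv.addRight (2 : ZMod k)).toEmbedding) := by
    rw [Finset.disjoint_right]
    intro i hi hi'
    obtain ⟨j, hj, rfl⟩ := Finset.mem_map.1 hi
    exact h j hj hi'
  have := Finset.card_le_univ (J ∪ J.map (Equiv.addRight (2 : ZMod k)).toEmbedding)
  rw [Finset.card_union_of_disjoint hd, Finset.card_map, ZMod.card] at this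
  obtain ⟨r, rfl⟩ := hk
  omega

lemma crossing_card_le_one {V : Type*} {G : SimpleGraph V} [DecidableRel G.Adj] {k : ℕ} [NeZero k]
    {x : ZMod k → V} (hinj : Function.Injective x) (hadj : ∀ i, G.Adj (x i) (x (i + 1)))
    (hno : ¬ HasCycle G (k + 2)) {a b : V} (ha : ∀ j, x j ≠ a) (hb : ∀ j, x j ≠ b) (hab : a ≠ b) :
    (Finset.univ.filter fun i => G.Adj a (x i) ∧ G.Adj b (x (i + 1))).card ≤ 1 := by
  rw [Finset.card_le_one]
  intro i hi j hj
  simp only [Finset.mem_filter, Finset.mem_univ, true_and] at hi hj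
  by_contra hij
  exact hno (hasCycle_of_crossing hinj hadj hij ha hb hab hi.1 hj.1 hi.2 hj.2)

/-- Two disjoint pairs of vertices off a `k`-cycle together see at most `k + 4` of its vertices,
unless there is a `(k + 2)`-cycle. -/
lemma card_add_card_le_of_disjoint_pairs {V : Type*} {G : SimpleGraph V} [DecidableRel G.Adj]
    {k : ℕ} [NeZero k] {x : ZMod k → V} (hinj : Function.Injective x)
    (hadj : ∀ i, G.Adj (x i) (x (i + 1))) (hno : ¬ HasCycle G (k + 2)) {a b c d : V}
    (ha : ∀ j, x j ≠ a) (hb : ∀ j, x j ≠ b) (hc : ∀ j, x j ≠ c) (hd : ∀ j, x j ≠ d)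
    (hac : a ≠ c) (had : a ≠ d) (hbc : b ≠ c) (hbd : b ≠ d) :
    (Finset.univ.filter fun i => G.Adj a (x i) ∨ G.Adj b (x i)).card +
      (Finset.univ.filter fun i => G.Adj c (x i) ∨ G.Adj d (x i)).card ≤ k + 4 := by
  set S := Finset.univ.filter fun i => G.Adj a (x i) ∨ G.Adj b (x i)
  set T := Finset.univ.filter fun i => G.Adj c (x (i + 1)) ∨ G.Adj d (x (i + 1)) with hT
  have hshift : (Finset.univ.filter fun i => G.Adj c (x i) ∨ G.Adj d (x i)).card = T.card := by
    refine (Finset.card_bij (fun i _ => i + 1) ?_ ?_ ?_).symm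
    · intro i hi
      simpa [hT] using hi
    · intro i _ j _ h
      exact add_right_cancel h
    · intro i hi
      exact ⟨i - 1, by simpa [hT] using hi, by simp⟩
  have hsub : S ∩ T ⊆
      ((Finset.univ.filter fun i => G.Adj a (x i) ∧ G.Adj c (x (i + 1))) ∪
        (Finset.univ.filter fun i => G.Adj a (x i) ∧ G.Adj d (x (i + 1)))) ∪
      ((Finset.univ.filter fun i => G.Adj b (x i) ∧ G.Adj c (x (i + 1))) ∪
        (Finset.univ.filter fun i => G.Adj b (x i) ∧ G.Adj d (x (i + 1)))) := by
    intro i hi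
    simp only [S, T, Finset.mem_inter, Finset.mem_union, Finset.mem_filter, Finset.mem_univ,
      true_and] at hi ⊢
    tauto
  have h1 := crossing_card_le_one hinj hadj hno ha hc hac
  have h2 := crossing_card_le_one hinj hadj hno ha hd had
  have h3 := crossing_card_le_one hinj hadj hno hb hc hbc
  have h4 := crossing_card_le_one hinj hadj hno hb hd hbd
  have h5 := (Finset.card_le_card hsub).trans ((Finset.card_union_le _ _).trans
    (add_le_add (Finset.card_union_le _ _) (Finset.card_union_le _ _)))
  have h6 := Finset.card_union_add_card_inter S T
  have h7 := Finset.card_le_univ (S ∪ T)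
  rw [ZMod.card] at h7
  omega

/-- If any two neighbourhoods cover half of the vertices, then an odd cycle extends by two. -/
lemma hasCycle_add_two {V : Type*} [Fintype V] [DecidableEq V] (G : SimpleGraph V)
    [DecidableRel G.Adj] {n k : ℕ} (hV : Fintype.card V = 2 * n + 2)
    (hunion : ∀ u v, u ≠ v → n + 1 ≤ (G.neighborFinset u ∪ G.neighborFinset v).card)
    (hdeg : ∀ v, k + 8 ≤ G.degree v) (hk : 3 ≤ k) (hodd : Odd k) (hkn : 2 * k ≤ n)
    (hcyc : HasCycle G k) : HasCycle G (k + 2) := by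
  by_contra hno
  have : NeZero k := ⟨by omega⟩
  obtain ⟨x, hinj, hadj⟩ := hcyc
  set C : Finset V := Finset.univ.image x with hC
  have hCcard : C.card = k := by
    rw [hC, Finset.card_image_of_injective _ hinj, Finset.card_univ, ZMod.card]
  have hoff : ∀ {v}, v ∉ C → ∀ j, x j ≠ v := by
    rintro v hv j rfl
    exact hv (by simp [hC])
  let U : V → V → Finset (ZMod k) := fun a b =>
    Finset.univ.filter fun i => G.Adj a (x i) ∨ G.Adj b (x i)
  let P : ZMod k → Finset V → Prop := fun i A => ∃ a b, a ≠ b ∧ A = {a, b} ∧ a ∉ C ∧ b ∉ C ∧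
    G.Adj a (x i) ∧ G.Adj b (x i) ∧ 2 * (U a b).card ≤ k + 3
  have hP : ∀ i (F : Finset V), F.card ≤ 4 →
      ∃ A : Finset V, A.card ≤ 2 ∧ Disjoint A F ∧ P i A := by
    intro i F hF
    have hT : 4 ≤ ((G.neighborFinset (x i) \ C) \ F).card := by
      have h1 := Finset.le_card_sdiff C (G.neighborFinset (x i))
      have h2 := Finset.le_card_sdiff F (G.neighborFinset (x i) \ C)
      have h3 := hdeg (x i)
      rw [G.card_neighborFinset_eq_degree] at h1
      omega
    obtain ⟨Q, hQ, hQ4⟩ := Finset.exists_subset_card_eq hT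
    obtain ⟨a, b, c, d, hab, hac, had, hbc, hbd, hcd, rfl⟩ := Finset.card_eq_four.1 hQ4
    have hmem : ∀ v ∈ ({a, b, c, d} : Finset V), v ∉ C ∧ v ∉ F ∧ G.Adj v (x i) := by
      intro v hv
      have := hQ hv
      simp only [Finset.mem_sdiff, mem_neighborFinset] at this
      exact ⟨this.1.2, this.2, this.1.1.symm⟩
    obtain ⟨ha, haF, hai⟩ := hmem a (by simp)
    obtain ⟨hb, hbF, hbi⟩ := hmem b (by simp)
    obtain ⟨hc, hcF, hci⟩ := hmem c (by simp)
    obtain ⟨hd, hdF, hdi⟩ := hmem d (by simp)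
    have hsum : (U a b).card + (U c d).card ≤ k + 4 :=
      card_add_card_le_of_disjoint_pairs hinj hadj hno (hoff ha) (hoff hb) (hoff hc) (hoff hd)
        hac had hbc hbd
    obtain ⟨r, hr⟩ := hodd
    by_cases h : 2 * (U a b).card ≤ k + 3
    · exact ⟨{a, b}, Finset.card_le_two, by simp [haF, hbF], a, b, hab, rfl, ha, hb, hai, hbi, h⟩
    · exact ⟨{c, d}, Finset.card_le_two, by simp [hcF, hdF], c, d, hcd, rfl, hc, hd, hci, hdi,
        by omega⟩
  -- Choose the pairs so that those at cyclic distance two are disjoint.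
  obtain ⟨s, hs⟩ : ∃ s : ZMod k, s * 2 = 1 := by
    obtain ⟨r, hr⟩ := hodd
    refine ⟨((r + 1 : ℕ) : ZMod k), ?_⟩
    have h : ((2 * r + 1 : ℕ) : ZMod k) = 0 := by rw [← hr]; simp
    push_cast at h ⊢
    linear_combination h
  obtain ⟨A, hA⟩ := exists_consecutive_disjoint_choice (by omega)
    (fun i => P (2 * i)) (fun i => hP (2 * i))
  have hpairs : ∀ i, P i (A (s * i)) ∧ Disjoint (A (s * i)) (A (s * (i + 2))) := by
    intro i
    have h := hA (s * i)
    rw [show 2 * (s * i) = i by linear_combination i * hs] at h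
    rwa [show s * (i + 2) = s * i + 1 by linear_combination hs]
  choose hpair hdisj using hpairs
  choose a b hab hAab ha hb hai hbi hU using hpair
  let M : ZMod k → Finset V := fun i => (G.neighborFinset (a i) ∪ G.neighborFinset (b i)) \ C
  have hMcard : ∀ i, 2 * n ≤ 2 * (M i).card + k + 1 := by
    intro i
    have hsub : G.neighborFinset (a i) ∪ G.neighborFinset (b i) ⊆
        M i ∪ (U (a i) (b i)).image x := by
      intro v hv
      by_cases hvC : v ∈ C
      · obtain ⟨j, -, rfl⟩ := Finset.mem_image.1 hvC
        refine Finset.mem_union_right _ (Finset.mem_image_of_mem _ ?_)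
        simpa [U] using hv
      · exact Finset.mem_union_left _ (Finset.mem_sdiff.2 ⟨hv, hvC⟩)
    have h1 := (Finset.card_le_card hsub).trans (Finset.card_union_le _ _)
    have h2 : ((U (a i) (b i)).image x).card ≤ _ := Finset.card_image_le
    have h3 := hunion _ _ (hab i)
    have h4 := hU i
    omega
  have hMdisj : ∀ c i, c ∈ M i → c ∉ M (i + 2) := by
    intro c i h1 h2
    simp only [M, Finset.mem_sdiff, Finset.mem_union, mem_neighborFinset] at h1 h2
    have hd := hdisj i
    rw [hAab i, hAab (i + 2)] at hd
    simp only [Finset.disjoint_insert_left, Finset.disjoint_singleton_left, Finset.mem_insert,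
      Finset.mem_singleton, not_or] at hd
    have key : ∀ u w, u ∉ C → w ∉ C → u ≠ w → G.Adj u (x i) → G.Adj w (x (i + 2)) →
        G.Adj u c → G.Adj w c → False := fun u w hu hw huw hui hwi huc hwc =>
      hno (hasCycle_of_detour hk hinj hadj (hoff hu) (hoff h1.2) (hoff hw) huw hui huc hwc.symm hwi)
    rcases h1.1 with h | h <;> rcases h2.1 with h' | h'
    · exact key _ _ (ha i) (ha _) hd.1.1 (hai i) (hai _) h h'
    · exact key _ _ (ha i) (hb _) hd.1.2 (hai i) (hbi _) h h'
    · exact key _ _ (hb i) (ha _) hd.2.1 (hbi i) (hai _) h h'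
    · exact key _ _ (hb i) (hb _) hd.2.2 (hbi i) (hbi _) h h'
  have hcount : ∑ i, (M i).card = ∑ c ∈ Cᶜ, (Finset.univ.filter fun i => c ∈ M i).card := by
    refine (Finset.sum_congr rfl fun i _ => congrArg _ ?_).trans
      (Finset.sum_card_bipartiteAbove_eq_sum_card_bipartiteBelow (t := Cᶜ) (fun i c => c ∈ M i))
    ext c
    simp +contextual [M, Finset.bipartiteAbove]
  have hlow : k * (2 * n) ≤ 2 * ∑ i, (M i).card + k * (k + 1) := by
    have := Finset.sum_le_sum fun i (_ : i ∈ (Finset.univ : Finset (ZMod k))) => hMcard i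
    simp only [Finset.sum_add_distrib, Finset.sum_const, Finset.card_univ, ZMod.card, smul_eq_mul,
      ← Finset.mul_sum] at this
    linarith
  have hup : 2 * ∑ i, (M i).card ≤ (2 * n + 2 - k) * (k - 1) := by
    rw [hcount, Finset.mul_sum]
    refine (Finset.sum_le_card_nsmul _ _ (k - 1) fun c _ => ?_).trans ?_
    · refine card_le_of_shift_disjoint hodd _ fun i hi => ?_
      simp only [Finset.mem_filter, Finset.mem_univ, true_and] at hi ⊢
      exact hMdisj c i hi
    · rw [Finset.card_compl, hV, hCcard, smul_eq_mul]
  obtain ⟨p, hp⟩ : ∃ p, 2 * n + 2 = p + k := ⟨2 * n + 2 - k, by omega⟩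
  obtain ⟨q, rfl⟩ : ∃ q, k = q + 1 := ⟨k - 1, by omega⟩
  rw [hp] at hup
  simp only [Nat.add_sub_cancel] at hup
  nlinarith

lemma exists_walk_of_sequence {V : Type*} {G : SimpleGraph V} {y : ℕ → V} {k : ℕ}
    (adj : ∀ t < k, G.Adj (y t) (y (t + 1))) {i j : ℕ} (hij : i ≤ j) (hj : j ≤ k) :
    ∃ w : G.Walk (y i) (y j), w.length = j - i := by
  induction j, hij using Nat.le_induction with
  | base => exact ⟨Walk.nil, by simp⟩
  | succ j hij ih =>
    obtain ⟨w, hw⟩ := ih (by omega)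
    exact ⟨w.concat (adj j (by omega)), by rw [Walk.length_concat, hw]; omega⟩

/-- A non-bipartite graph of minimum degree about a quarter of its order has an odd cycle of
length at most seven: a vertex has at most two neighbours on a shortest odd closed walk. -/
lemma exists_short_odd_cycle {V : Type*} [Fintype V] (G : SimpleGraph V)
    [DecidableRel G.Adj] {n : ℕ} (hn : 9 ≤ n) (hV : Fintype.card V = 2 * n + 2)
    (hdeg : ∀ v, n ≤ 2 * G.degree v) (hcol : ¬ G.Colorable 2) :
    ∃ g, Odd g ∧ 3 ≤ g ∧ g ≤ 7 ∧ HasCycle G g := by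
  classical
  have hex : ∃ g, Odd g ∧ ∃ u, ∃ w : G.Walk u u, w.length = g := by
    rw [two_colorable_iff_forall_loop_even] at hcol
    push Not at hcol
    obtain ⟨u, w, hw⟩ := hcol
    exact ⟨w.length, Nat.not_even_iff_odd.1 hw, u, w, rfl⟩
  obtain ⟨hodd, u, w, hw⟩ := Nat.find_spec hex
  have hmin : ∀ {v} (p : G.Walk v v), Odd p.length → Nat.find hex ≤ p.length := fun p hp =>
    Nat.find_min' hex ⟨hp, _, p, rfl⟩
  generalize Nat.find hex = g at hodd hw hmin
  set y : ℕ → V := w.getVert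
  have yadj : ∀ t < g, G.Adj (y t) (y (t + 1)) := fun t ht =>
    w.adj_getVert_succ (by omega)
  have y0 : y 0 = y g := by simp [y, ← hw]
  have harcs : ∀ i j, i ≤ j → j ≤ g →
      (∃ p : G.Walk (y i) (y j), p.length = j - i) ∧
      ∃ p : G.Walk (y j) (y i), p.length = g - (j - i) := by
    intro i j hij hj
    refine ⟨exists_walk_of_sequence yadj hij hj, ?_⟩
    obtain ⟨p, hp⟩ := exists_walk_of_sequence yadj hj le_rfl
    obtain ⟨q, hq⟩ := exists_walk_of_sequence yadj (Nat.zero_le i) (hij.trans hj)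
    exact ⟨p.append (q.copy y0 rfl), by rw [Walk.length_append, Walk.length_copy, hp, hq]; omega⟩
  have hinj' : ∀ i j, i < j → j < g → y i ≠ y j := by
    intro i j hij hj h
    obtain ⟨⟨p, hp⟩, q, hq⟩ := harcs i j hij.le hj.le
    have h1 := hmin (p.copy rfl h.symm)
    have h2 := hmin (q.copy rfl h)
    rw [Walk.length_copy, hp] at h1
    rw [Walk.length_copy, hq] at h2
    grind
  have hg1 : g ≠ 1 := by
    rintro rfl
    exact (yadj 0 (by omega)).ne y0
  have hg3 : 3 ≤ g := by grind
  refine ⟨g, hodd, hg3, ?_, hasCycle_of_sequence (by omega) y ?_ (fun t ht => yadj t (by omega)) ?_⟩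
  · by_contra hg
    have hnbr : ∀ v i j, i < j → j < g → G.Adj v (y i) → G.Adj v (y j) →
        j - i = 2 ∨ j - i = g - 2 := by
      intro v i j hij hj hi hj'
      obtain ⟨⟨p, hp⟩, q, hq⟩ := harcs i j hij.le hj.le
      have h1 := hmin (Walk.cons hi (p.concat hj'.symm))
      have h2 := hmin (Walk.cons hj' (q.concat hi.symm))
      rw [Walk.length_cons, Walk.length_concat, hp] at h1
      rw [Walk.length_cons, Walk.length_concat, hq] at h2
      grind
    have htwo : ∀ v, ((Finset.range g).filter fun i => G.Adj (y i) v).card ≤ 2 := by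
      intro v
      by_contra h
      obtain ⟨a, ha, b, hb, c, hc, hab, hac, hbc⟩ := Finset.two_lt_card.1 (not_le.1 h)
      simp only [Finset.mem_filter, Finset.mem_range] at ha hb hc
      have hpair : ∀ i j, i < g → j < g → G.Adj (y i) v → G.Adj (y j) v → i ≠ j →
          j - i = 2 ∨ i - j = 2 ∨ j - i = g - 2 ∨ i - j = g - 2 := by
        intro i j hi hj hi' hj' hij
        rcases lt_or_gt_of_ne hij with h | h
        · have := hnbr v i j h hj hi'.symm hj'.symm; omega
        · have := hnbr v j i h hi hj'.symm hi'.symm; omega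
      have h1 := hpair a b ha.1 hb.1 ha.2 hb.2 hab
      have h2 := hpair a c ha.1 hc.1 ha.2 hc.2 hac
      have h3 := hpair b c hb.1 hc.1 hb.2 hc.2 hbc
      obtain ⟨r, rfl⟩ := hodd
      omega
    have hcount : ∑ i ∈ Finset.range g, G.degree (y i) =
        ∑ v : V, ((Finset.range g).filter fun i => G.Adj (y i) v).card := by
      refine (Finset.sum_congr rfl fun i _ => ?_).trans
        (Finset.sum_card_bipartiteAbove_eq_sum_card_bipartiteBelow (fun i v => G.Adj (y i) v))
      rw [← G.card_neighborFinset_eq_degree, neighborFinset_eq_filter]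
      rfl
    have hup := Finset.sum_le_card_nsmul Finset.univ _ 2 fun v _ => htwo v
    rw [← hcount, Finset.card_univ, hV, smul_eq_mul] at hup
    have hlow := Finset.card_nsmul_le_sum (Finset.range g) (fun i => 2 * G.degree (y i)) n
      fun i _ => hdeg _
    rw [← Finset.mul_sum, Finset.card_range, smul_eq_mul] at hlow
    have : 9 ≤ g := by grind
    nlinarith
  · intro s t hs ht h
    rcases lt_trichotomy s t with h' | h' | h'
    · exact absurd h (hinj' s t h' ht)
    · exact h'
    · exact absurd h.symm (hinj' t s h' hs)
  · have := yadj (g - 1) (by omega)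
    rwa [show g - 1 + 1 = g by omega, ← y0] at this

lemma hasCycle_of_not_colorable {V : Type*} [Fintype V] [DecidableEq V] (G : SimpleGraph V)
    [DecidableRel G.Adj] {n m : ℕ} (hV : Fintype.card V = 2 * n + 2)
    (hunion : ∀ u v, u ≠ v → n + 1 ≤ (G.neighborFinset u ∪ G.neighborFinset v).card)
    (hdeg : ∀ v, n ≤ 2 * G.degree v) (hcol : ¬ G.Colorable 2)
    (hm : 7 ≤ m) (hmodd : Odd m) (hnm : 2 * m + 16 ≤ n) : HasCycle G m := by
  obtain ⟨g, hg, hg3, hg7, hcyc⟩ := exists_short_odd_cycle G (by omega) hV hdeg hcol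
  have key : ∀ r, g + 2 * r ≤ m → HasCycle G (g + 2 * r) := by
    intro r
    induction r with
    | zero => intro _; simpa using hcyc
    | succ r ih =>
      intro hr
      have hodd : Odd (g + 2 * r) := by grind
      refine hasCycle_add_two (k := g + 2 * r) G hV hunion (fun v => ?_) (by omega) hodd
        (by omega) (ih (by omega))
      have := hdeg v; omega
  obtain ⟨a, rfl⟩ := hg
  obtain ⟨b, rfl⟩ := hmodd
  have := key (b - a) (by omega)
  rwa [show 2 * a + 1 + 2 * (b - a) = 2 * b + 1 by omega] at this

lemma HasCycle.containsCopy {V : Type*} {G : SimpleGraph V} {m : ℕ} (hm : 2 ≤ m)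
    (h : HasCycle G m) : ContainsCopy G (cycleGraph m) := by
  obtain ⟨m, rfl⟩ : ∃ r, m = r + 2 := ⟨m - 2, by omega⟩
  obtain ⟨x, hinj, hadj⟩ := h
  refine ⟨⟨x, ?_⟩, hinj⟩
  intro u v huv
  rw [cycleGraph_adj] at huv
  rcases huv with h | h
  · rw [sub_eq_iff_eq_add.1 h, add_comm]; exact (hadj v).symm
  · rw [sub_eq_iff_eq_add.1 h, add_comm]; exact hadj u

lemma HasCycle.map {V W : Type*} {G : SimpleGraph V} {H : SimpleGraph W} {k : ℕ} (f : G ↪g H)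
    (h : HasCycle G k) : HasCycle H k := by
  obtain ⟨x, hinj, hadj⟩ := h
  exact ⟨f ∘ x, f.injective.comp hinj, fun i => f.map_rel_iff.2 (hadj i)⟩

/-- If any two neighbourhoods cover more than half of the vertices, then deleting a vertex of
minimum degree does not leave a bipartite graph. -/
lemma not_colorable_of_neighborFinset_union {V : Type*} [Fintype V] [DecidableEq V]
    (G : SimpleGraph V) [DecidableRel G.Adj] {n : ℕ} (hn : 5 ≤ n)
    (hV : Fintype.card V = 2 * n + 3)
    (hunion : ∀ u v, u ≠ v → n + 2 ≤ (G.neighborFinset u ∪ G.neighborFinset v).card) {z : V}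
    (hz : ∀ v, G.degree z ≤ G.degree v) : ¬ (G.induce {z}ᶜ).Colorable 2 := by
  rintro ⟨c⟩
  let A : Fin 2 → Finset V := fun e => Finset.univ.filter fun v => ∃ h : v ≠ z, c ⟨v, h⟩ = e
  have hA : ∀ e v, v ∈ A e ↔ ∃ h : v ≠ z, c ⟨v, h⟩ = e := by simp [A]
  have hnbr : ∀ e e', e ≠ e' → ∀ v ∈ A e, G.neighborFinset v ⊆ insert z (A e') := by
    intro e e' hee v hv w hw
    obtain ⟨hvz, hcv⟩ := (hA e v).1 hv
    rw [mem_neighborFinset] at hw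
    by_cases hwz : w = z
    · simp [hwz]
    · refine Finset.mem_insert_of_mem ((hA _ _).2 ⟨hwz, ?_⟩)
      have hne : c ⟨v, hvz⟩ ≠ c ⟨w, hwz⟩ := c.valid (by simpa using hw)
      omega
  have hzA : ∀ e, z ∉ A e := fun e h => ((hA e z).1 h).1 rfl
  have hun : A 0 ∪ A 1 = Finset.univ.erase z := by
    ext v
    simp only [Finset.mem_union, hA, Finset.mem_erase, Finset.mem_univ, and_true]
    constructor
    · rintro (⟨h, -⟩ | ⟨h, -⟩) <;> exact h
    · intro h
      have : c ⟨v, h⟩ = 0 ∨ c ⟨v, h⟩ = 1 := by omega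
      exact this.imp (fun h' => ⟨h, h'⟩) (fun h' => ⟨h, h'⟩)
  have hcard : (A 0).card + (A 1).card = 2 * n + 2 := by
    have hdisj : Disjoint (A 0) (A 1) := by
      rw [Finset.disjoint_left]
      intro v h0 h1
      obtain ⟨h, h'⟩ := (hA _ _).1 h0
      obtain ⟨_, h''⟩ := (hA _ _).1 h1
      rw [h'] at h''
      exact absurd h'' (by decide)
    rw [← Finset.card_union_of_disjoint hdisj, hun, Finset.card_erase_of_mem (Finset.mem_univ _),
      Finset.card_univ, hV]
    rfl
  have hbig : ∀ e e', e ≠ e' → 2 ≤ (A e).card → n + 1 ≤ (A e').card := by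
    intro e e' hee h
    obtain ⟨u, hu, v, hv, huv⟩ := Finset.one_lt_card.1 h
    have := (hunion u v huv).trans (Finset.card_le_card
      (Finset.union_subset (hnbr e e' hee u hu) (hnbr e e' hee v hv)))
    have := Finset.card_insert_le z (A e')
    omega
  have h01 := hbig 0 1 (by decide)
  have h10 := hbig 1 0 (by decide)
  -- Both classes have `n + 1` vertices, so `z` misses at most one vertex of each.
  have hmiss : ∀ e e', e ≠ e' → (A e').card ≤ n + 1 →
      (A e \ G.neighborFinset z).card ≤ 1 := by
    intro e e' hee hle
    rw [Finset.card_le_one]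
    intro u hu v hv
    simp only [Finset.mem_sdiff, mem_neighborFinset] at hu hv
    by_contra huv
    have hsub : G.neighborFinset u ∪ G.neighborFinset v ⊆ A e' := by
      intro w hw
      have hw' := Finset.union_subset (hnbr e e' hee u hu.1) (hnbr e e' hee v hv.1) hw
      rcases Finset.mem_insert.1 hw' with rfl | h
      · simp only [Finset.mem_union, mem_neighborFinset] at hw
        exact absurd hw (by rw [G.adj_comm u, G.adj_comm v]; tauto)
      · exact h
    have := (hunion u v huv).trans (Finset.card_le_card hsub)
    omega
  have hmiss0 := hmiss 0 1 (by decide) (by omega)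
  have hmiss1 := hmiss 1 0 (by decide) (by omega)
  have h0 := Finset.le_card_sdiff (G.neighborFinset z) (A 0 ∪ A 1)
  rw [Finset.union_sdiff_distrib, hun, Finset.card_erase_of_mem (Finset.mem_univ _),
    Finset.card_univ, hV, G.card_neighborFinset_eq_degree] at h0
  have h1 := Finset.card_union_le (A 0 \ G.neighborFinset z) (A 1 \ G.neighborFinset z)
  obtain ⟨v, hv⟩ : (A 0).Nonempty := Finset.card_pos.1 (by omega)
  have h2 := Finset.card_le_card (hnbr 0 1 (by decide) v hv)
  have h3 := Finset.card_insert_le z (A 1)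
  rw [G.card_neighborFinset_eq_degree] at h2
  have h4 := hz v
  omega

lemma hasCycle_of_neighborFinset_union {V : Type*} [Fintype V] [DecidableEq V]
    (G : SimpleGraph V) [DecidableRel G.Adj] {n m : ℕ} (hV : Fintype.card V = 2 * n + 3)
    (hunion : ∀ u v, u ≠ v → n + 2 ≤ (G.neighborFinset u ∪ G.neighborFinset v).card)
    (hm : 7 ≤ m) (hmodd : Odd m) (hnm : 2 * m + 16 ≤ n) : HasCycle G m := by
  have : Nonempty V := Fintype.card_pos_iff.1 (by omega)
  obtain ⟨z, hz⟩ := Finite.exists_min fun v => G.degree v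
  have himage : ∀ v : ({z}ᶜ : Set V), ((G.induce {z}ᶜ).neighborFinset v).map
      (Function.Embedding.subtype _) = (G.neighborFinset v).erase z := by
    intro v
    ext w
    simp [and_comm]
  refine HasCycle.map (Embedding.induce {z}ᶜ) (hasCycle_of_not_colorable (n := n) _ ?_ ?_ ?_
    (not_colorable_of_neighborFinset_union G (by omega) hV hunion hz) hm hmodd hnm)
  · rw [Fintype.card_compl_set, hV]
    simp
  · intro u v huv
    rw [← Finset.card_map (Function.Embedding.subtype _), Finset.map_union, himage, himage,
      ← Finset.erase_union_distrib]
    have := hunion u v (by simpa [Subtype.ext_iff] using huv)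
    have := Finset.pred_card_le_card_erase (s := G.neighborFinset (u : V) ∪ G.neighborFinset v)
      (a := z)
    omega
  · intro v
    rw [← card_neighborFinset_eq_degree, ← Finset.card_map (Function.Embedding.subtype _), himage]
    have h1 := hunion v z v.2
    have h2 := Finset.card_union_le (G.neighborFinset (v : V)) (G.neighborFinset z)
    have h3 := hz v
    have h4 := Finset.pred_card_le_card_erase (s := G.neighborFinset (v : V)) (a := z)
    simp only [card_neighborFinset_eq_degree] at h2 h4
    omega

/-- In a graph without `K_{2,n}`, two vertices have fewer than `n` common neighbours. -/
lemma card_inter_neighborFinset_lt {V : Type*} [Fintype V] [DecidableEq V]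
    (Γ : SimpleGraph V) [DecidableRel Γ.Adj] {n : ℕ}
    (h : ¬ ContainsCopy Γ (completeBipartiteGraph (Fin 2) (Fin n))) {u v : V} (huv : u ≠ v) :
    (Γ.neighborFinset u ∩ Γ.neighborFinset v).card < n := by
  by_contra! hn
  obtain ⟨S, hS, hcard⟩ := Finset.exists_subset_card_eq hn
  let e : Fin n ≃ S := (S.equivFinOfCardEq hcard).symm
  have hadj : ∀ i a, Γ.Adj (![u, v] i) (e a) := by
    intro i a
    have := hS (e a).2
    simp only [Finset.mem_inter, mem_neighborFinset] at this
    fin_cases i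
    · exact this.1
    · exact this.2
  refine h ⟨⟨Sum.elim ![u, v] (fun a => (e a : V)), ?_⟩, ?_⟩
  · rintro (i | a) (j | b) hij
    · simp at hij
    · exact hadj i b
    · exact (hadj j a).symm
    · simp at hij
  · refine Function.Injective.sumElim ?_ (Subtype.val_injective.comp e.injective)
      (fun i a => (hadj i a).ne)
    intro i j hij
    fin_cases i <;> fin_cases j <;> simp_all [eq_comm]

lemma le_card_union_neighborFinset_compl {V : Type*} [Fintype V] [DecidableEq V]
    (Γ : SimpleGraph V) [DecidableRel Γ.Adj] {n : ℕ} (hV : Fintype.card V = 2 * n + 3)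
    (h : ¬ ContainsCopy Γ (completeBipartiteGraph (Fin 2) (Fin n))) {u v : V} (huv : u ≠ v) :
    n + 2 ≤ (Γᶜ.neighborFinset u ∪ Γᶜ.neighborFinset v).card := by
  have hcover : (Finset.univ : Finset V) ⊆ ((Γᶜ.neighborFinset u ∪ Γᶜ.neighborFinset v) ∪
      (Γ.neighborFinset u ∩ Γ.neighborFinset v)) ∪ {u, v} := by
    intro w _
    simp only [Finset.mem_union, Finset.mem_inter, mem_neighborFinset, compl_adj,
      Finset.mem_insert, Finset.mem_singleton]
    grind
  have h1 := Finset.card_le_card hcover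
  rw [Finset.card_univ, hV] at h1
  have h2 := Finset.card_union_le ((Γᶜ.neighborFinset u ∪ Γᶜ.neighborFinset v) ∪
    (Γ.neighborFinset u ∩ Γ.neighborFinset v)) {u, v}
  have h3 := Finset.card_union_le (Γᶜ.neighborFinset u ∪ Γᶜ.neighborFinset v)
    (Γ.neighborFinset u ∩ Γ.neighborFinset v)
  have h4 := card_inter_neighborFinset_lt Γ h huv
  have h5 : ({u, v} : Finset V).card ≤ 2 := Finset.card_le_two
  omega

/-- The disjoint union of two complete graphs of order `n + 1`. -/
def twoCliques (n : ℕ) : SimpleGraph (Fin (2 * n + 2)) where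
  Adj u v := u ≠ v ∧ ((u : ℕ) ≤ n ↔ (v : ℕ) ≤ n)
  symm := ⟨fun _ _ h => ⟨h.1.symm, h.2.symm⟩⟩
  loopless := ⟨fun _ h => h.1 rfl⟩

lemma not_containsCopy_twoCliques {n : ℕ} (hn : n ≠ 0) :
    ¬ ContainsCopy (twoCliques n) (completeBipartiteGraph (Fin 2) (Fin n)) := by
  rintro ⟨f, hf⟩
  have hadj : ∀ i a, (f (.inl i) : ℕ) ≤ n ↔ (f (.inr a) : ℕ) ≤ n := fun i a =>
    (f.map_rel (show (completeBipartiteGraph (Fin 2) (Fin n)).Adj (.inl i) (.inr a) by simp)).2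
  let a : Fin n := ⟨0, Nat.pos_of_ne_zero hn⟩
  have hside : ∀ w, (f w : ℕ) ≤ n ↔ (f (.inr a) : ℕ) ≤ n := by
    rintro (i | b)
    · exact hadj i a
    · exact (hadj 0 b).symm.trans (hadj 0 a)
  -- Reducing modulo `n + 1` is injective on each clique.
  let g : Fin 2 ⊕ Fin n → Fin (n + 1) := fun w => ⟨(f w : ℕ) % (n + 1), Nat.mod_lt _ (by omega)⟩
  have hg : Function.Injective g := by
    intro w w' h
    apply hf
    have h' : (f w : ℕ) % (n + 1) = (f w' : ℕ) % (n + 1) := congrArg Fin.val h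
    have h1 := hside w
    have h2 := hside w'
    have h3 := (f w).2
    have h4 := (f w').2
    ext
    by_cases hc : (f (.inr a) : ℕ) ≤ n
    · rwa [Nat.mod_eq_of_lt (by omega), Nat.mod_eq_of_lt (by omega)] at h'
    · rw [Nat.mod_eq_sub_mod (by omega), Nat.mod_eq_of_lt (by omega),
        Nat.mod_eq_sub_mod (by omega), Nat.mod_eq_of_lt (by omega)] at h'
      omega
  have := Fintype.card_le_of_injective g hg
  simp at this
  omega

lemma not_containsCopy_compl_twoCliques {n m : ℕ} (hm : 2 ≤ m) (hodd : Odd m) :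
    ¬ ContainsCopy (twoCliques n)ᶜ (cycleGraph m) := by
  rintro ⟨f, -⟩
  have hcol : (twoCliques n)ᶜ.Colorable 2 := by
    refine ⟨Coloring.mk (fun v => if (v : ℕ) ≤ n then 0 else 1) ?_⟩
    intro u v huv
    have h : ¬ ((u : ℕ) ≤ n ↔ (v : ℕ) ≤ n) := fun h => huv.2 ⟨huv.1, h⟩
    split_ifs <;> simp_all
  have h := (hcol.of_hom f).chromaticNumber_le
  rw [chromaticNumber_cycleGraph_of_odd m hm hodd] at h
  exact absurd h (by decide)

/-- For every odd `m ≥ 7` and every `n` with `n ≥ 2m + 499` and `n ≥ 3493`, the Ramsey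
number `R(K_{2,n}, C_m)` equals `2n + 3`. -/
theorem statement15 (n m : ℕ) (hm : 7 ≤ m) (hmodd : Odd m)
    (hn1 : 2 * m + 499 ≤ n) (hn2 : 3493 ≤ n) :
    (∀ Γ : SimpleGraph (Fin (2 * n + 3)),
        ContainsCopy Γ (completeBipartiteGraph (Fin 2) (Fin n)) ∨
        ContainsCopy Γᶜ (SimpleGraph.cycleGraph m)) ∧
    (∃ Γ : SimpleGraph (Fin (2 * n + 2)),
        ¬ ContainsCopy Γ (completeBipartiteGraph (Fin 2) (Fin n)) ∧
        ¬ ContainsCopy Γᶜ (SimpleGraph.cycleGraph m)) := by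
  refine ⟨fun Γ => ?_, twoCliques n, not_containsCopy_twoCliques (by omega),
    not_containsCopy_compl_twoCliques (by omega) hmodd⟩
  classical
  refine or_iff_not_imp_left.2 fun h => HasCycle.containsCopy (by omega) ?_
  have hV : Fintype.card (Fin (2 * n + 3)) = 2 * n + 3 := Fintype.card_fin _
  exact hasCycle_of_neighborFinset_union Γᶜ hV
    (fun u v huv => le_card_union_neighborFinset_compl Γ hV h huv) hm hmodd (by omega)
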